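/- Assume the continuum hypothesis. Let J be a nowhere maximal P⁺ ideal on ω and let I be an ideal on ω with the hBW property. If J ≰_BW I, then there exists a Hausdorff, non-compact topological space that has the BW(I) property but does not have the BW(J) property. -/

import Mathlib

open Set Filter Topology

/-- An ideal on a set `M`: closed under subsets and finite unions, contains all
finite sets, and is proper. -/
structure IsIdeal {M : Type*} (I : Set (Set M)) : Prop where
  mem_of_subset : ∀ ⦃A B : Set M⦄, A ⊆ B → B ∈ I → A ∈ I
  union_mem : ∀ ⦃A B : Set M⦄, A ∈ I → B ∈ I → A ∪ B ∈ I
  finite_mem : ∀ ⦃A : Set M⦄, A.Finite → A ∈ I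
  univ_not_mem : (Set.univ : Set M) ∉ I

/-- `BWle I J` formalizes `I ≤_BW J`, where `I` is an ideal on `N` and `J` is an
ideal on `M`: there is `f : M → N` such that for every `J`-positive `A` there is an
`I`-positive `B ⊆ f[A]` such that for every `C` with `C ∩ B` `I`-positive, the set
`A ∩ f⁻¹[C]` is `J`-positive. -/
def BWle {N M : Type*} (I : Set (Set N)) (J : Set (Set M)) : Prop :=
  ∃ f : M → N, ∀ A : Set M, A ∉ J →
    ∃ B : Set N, B ⊆ f '' A ∧ B ∉ I ∧
      ∀ C : Set N, C ∩ B ∉ I → A ∩ f ⁻¹' C ∉ J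

/-- The `BW(I)` property of a topological space `X`, for an ideal `I` on `M`:
every sequence `(x_m)_{m ∈ M}` in `X` admits an `I`-positive set `A` on which it is
`I`-convergent to some point. -/
def BWProp {M : Type*} (I : Set (Set M)) (X : Type*) [TopologicalSpace X] : Prop :=
  ∀ x : M → X, ∃ A : Set M, A ∉ I ∧ ∃ p : X,
    ∀ U : Set X, IsOpen U → p ∈ U → {n ∈ A | x n ∉ U} ∈ I

/-- The ideal `Fin` of finite subsets of `ω`. -/
def FinIdeal : Set (Set ℕ) := {A : Set ℕ | A.Finite}

/-- A `P⁺` ideal: every decreasing sequence of positive sets has a positive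
pseudo-intersection. -/
def IsPPlus (J : Set (Set ℕ)) : Prop :=
  ∀ A : ℕ → Set ℕ, (∀ n, A (n + 1) ⊆ A n) → (∀ n, A n ∉ J) →
    ∃ B : Set ℕ, B ∉ J ∧ ∀ n, (B \ A n).Finite

/-- A nowhere maximal ideal: every positive set splits into two positive pieces. -/
def IsNowhereMaximal (J : Set (Set ℕ)) : Prop :=
  ∀ A : Set ℕ, A ∉ J → ∃ B ⊆ A, B ∉ J ∧ A \ B ∉ J

/-- The `hBW` property of an ideal `I` on `ω`: for every `I`-positive `A`, every
sequence in `[0,1]` admits an `I`-positive `B ⊆ A` on which it is `I`-convergent. -/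
def HasHBW (I : Set (Set ℕ)) : Prop :=
  ∀ A : Set ℕ, A ∉ I → ∀ x : ℕ → Set.Icc (0 : ℝ) 1,
    ∃ B ⊆ A, B ∉ I ∧ ∃ p : Set.Icc (0 : ℝ) 1,
      ∀ U : Set (Set.Icc (0 : ℝ) 1), IsOpen U → p ∈ U → {n ∈ B | x n ∉ U} ∈ I

theorem aux_split (I : Set (Set ℕ)) (hI : IsIdeal I) (hIbw : HasHBW I) (A : Set ℕ) (hA : A ∉ I)
    (D : ℕ → Set ℕ) :
    ∃ A' ⊆ A, A' ∉ I ∧ ∀ k, A' ∩ D k ∈ I ∨ A' \ D k ∈ I := by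
  classical
  let e := cantorSetHomeomorphNatToBool
  let y : ℕ → (ℕ → Bool) := fun n k => decide (n ∈ D k)
  let x : ℕ → Set.Icc (0 : ℝ) 1 := fun n =>
    ⟨(e.symm (y n)).1, cantorSet_subset_unitInterval (e.symm (y n)).2⟩
  obtain ⟨B, hBA, hB, p, hp⟩ := hIbw A hA x
  refine ⟨B, hBA, hB, fun k => ?_⟩
  have hpc : p.1 ∈ cantorSet := by
    by_contra hpc
    have := hp {q | q.1 ∉ cantorSet}
      (isClosed_cantorSet.isOpen_compl.preimage continuous_subtype_val) hpc
    apply hB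
    refine hI.mem_of_subset ?_ this
    intro n hn
    refine ⟨hn, ?_⟩
    simp [x]
  let q : ℕ → Bool := e ⟨p.1, hpc⟩
  have ho : IsOpen {z : cantorSet | e z k = q k} := by
    have h1 : Continuous fun z : cantorSet => e z k := (continuous_apply k).comp e.continuous
    exact (isOpen_discrete {q k}).preimage h1
  obtain ⟨V, hV, hVe⟩ := isOpen_induced_iff.1 ho
  have hVz : ∀ z : cantorSet, z.1 ∈ V ↔ e z k = q k := fun z => by
    have : z ∈ (Subtype.val ⁻¹' V : Set cantorSet) ↔ z ∈ {z : cantorSet | e z k = q k} := by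
      rw [hVe]
    exact this
  have h2 := hp (Subtype.val ⁻¹' V) (hV.preimage continuous_subtype_val)
    ((hVz ⟨p.1, hpc⟩).2 rfl)
  have h3 : ∀ n, x n ∈ (Subtype.val ⁻¹' V : Set (Set.Icc (0 : ℝ) 1)) ↔ decide (n ∈ D k) = q k := by
    intro n
    have := hVz (e.symm (y n))
    rw [e.apply_symm_apply] at this
    exact this
  cases hq : q k
  · left
    refine hI.mem_of_subset ?_ h2
    rintro n ⟨hn, hnD⟩
    refine ⟨hn, ?_⟩
    rw [h3, hq]
    simpa using hnD
  · right
    refine hI.mem_of_subset ?_ h2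
    rintro n ⟨hn, hnD⟩
    refine ⟨hn, ?_⟩
    rw [h3, hq]
    simpa using hnD

theorem aux_split_countable (I : Set (Set ℕ)) (hI : IsIdeal I) (hIbw : HasHBW I) (A : Set ℕ)
    (hA : A ∉ I) {W : Type} (T : Set W) (hT : T.Countable) (D : W → Set ℕ) :
    ∃ A' ⊆ A, A' ∉ I ∧ ∀ k ∈ T, A' ∩ D k ∈ I ∨ A' \ D k ∈ I := by
  rcases T.eq_empty_or_nonempty with rfl | hne
  · exact ⟨A, Subset.rfl, hA, by simp⟩
  · obtain ⟨g, rfl⟩ := hT.exists_eq_range hne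
    obtain ⟨A', h1, h2, h3⟩ := aux_split I hI hIbw A hA (fun k => D (g k))
    refine ⟨A', h1, h2, ?_⟩
    rintro _ ⟨k, rfl⟩
    exact h3 k

theorem aux_finite_iUnion {M : Type*} (I : Set (Set M)) (hI : IsIdeal I) {ι : Type*} (F : Finset ι)
    (D : ι → Set M) (h : ∀ i ∈ F, D i ∈ I) : (⋃ i ∈ F, D i) ∈ I := by
  classical
  induction F using Finset.induction_on with
  | empty => simpa using hI.finite_mem Set.finite_empty
  | insert a F ha ih =>
    rw [Finset.set_biUnion_insert]
    exact hI.union_mem (h a (by simp)) (ih fun i hi => h i (by simp [hi]))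

theorem aux_conv (I : Set (Set ℕ)) (hI : IsIdeal I) {ι : Type} (S : Set (ι → Bool)) (x : ℕ → S)
    (A : Set ℕ) (p : S) (h : ∀ i, {n ∈ A | (x n).1 i ≠ p.1 i} ∈ I) :
    ∀ U : Set S, IsOpen U → p ∈ U → {n ∈ A | x n ∉ U} ∈ I := by
  intro U hU hpU
  obtain ⟨V, hV, rfl⟩ := isOpen_induced_iff.1 hU
  obtain ⟨F, u, hu, hF⟩ := isOpen_pi_iff.1 hV p.1 hpU
  refine hI.mem_of_subset ?_ (aux_finite_iUnion I hI F _ fun i _ => h i)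
  rintro n ⟨hn, hnU⟩
  by_contra hcon
  apply hnU
  apply hF
  intro i hi
  have : (x n).1 i = p.1 i := by
    by_contra hne
    exact hcon (Set.mem_iUnion₂.2 ⟨i, hi, hn, hne⟩)
  rw [this]
  exact (hu i hi).2

/-- The underlying set of the space. -/
def auxSpace {W : Type} (pt : ℕ → (W ⊕ ℕ → Bool)) : Set (W ⊕ ℕ → Bool) :=
  {y | (∃ n, y = pt n) ∨
    ((∀ m, y (Sum.inr m) = false) ∧ {w | y (Sum.inl w) = true}.Countable)}

theorem aux_limit (I : Set (Set ℕ)) (hI : IsIdeal I) (hIbw : HasHBW I) {W : Type}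
    (pt : ℕ → (W ⊕ ℕ → Bool)) (x : ℕ → auxSpace pt) (A : Set ℕ) (hA : A ∉ I)
    (T : Set W) (hT : T.Countable)
    (h1 : ∀ w ∉ T, {n ∈ A | (x n).1 (Sum.inl w) = true} ∈ I)
    (h2 : ∀ m, {n ∈ A | (x n).1 (Sum.inr m) = true} ∈ I) :
    ∃ A : Set ℕ, A ∉ I ∧ ∃ p : auxSpace pt,
      ∀ U : Set (auxSpace pt), IsOpen U → p ∈ U → {n ∈ A | x n ∉ U} ∈ I := by
  classical
  obtain ⟨B, hBA, hB, hd⟩ := aux_split_countable I hI hIbw A hA T hT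
    (fun w => {n | (x n).1 (Sum.inl w) = true})
  let p : W ⊕ ℕ → Bool := Sum.elim
    (fun w => decide (w ∈ T ∧ B \ {n | (x n).1 (Sum.inl w) = true} ∈ I)) (fun _ => false)
  have hp : p ∈ auxSpace pt := by
    right
    refine ⟨fun m => rfl, hT.mono ?_⟩
    intro w hw
    have hw' : w ∈ T ∧ B \ {n | (x n).1 (Sum.inl w) = true} ∈ I := of_decide_eq_true hw
    exact hw'.1
  refine ⟨B, hB, ⟨p, hp⟩, aux_conv I hI _ x B ⟨p, hp⟩ ?_⟩
  rintro (w | m)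
  · by_cases hw : w ∈ T ∧ B \ {n | (x n).1 (Sum.inl w) = true} ∈ I
    · refine hI.mem_of_subset ?_ hw.2
      rintro n ⟨hn, hne⟩
      refine ⟨hn, ?_⟩
      simpa [p, hw.1, hw.2] using hne
    · have hpw : p (Sum.inl w) = false := decide_eq_false hw
      have hmem : B ∩ {n | (x n).1 (Sum.inl w) = true} ∈ I := by
        by_cases hwT : w ∈ T
        · rcases hd w hwT with h | h
          · exact h
          · exact (hw ⟨hwT, h⟩).elim
        · exact hI.mem_of_subset (B := {n ∈ A | (x n).1 (Sum.inl w) = true})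
            (fun n hn => ⟨hBA hn.1, hn.2⟩) (h1 w hwT)
      refine hI.mem_of_subset ?_ hmem
      rintro n ⟨hn, hne⟩
      refine ⟨hn, ?_⟩
      simpa [hpw] using hne
  · refine hI.mem_of_subset ?_ (h2 m)
    rintro n ⟨hn, hne⟩
    refine ⟨hBA hn, ?_⟩
    simpa [p] using hne

theorem aux_density (J : Set (Set ℕ)) (hJ : IsIdeal J) (I : Set (Set ℕ)) (hI : IsIdeal I)
    (h : ¬ BWle J I) (f : ℕ → ℕ) :
    ∃ A : Set ℕ, A ∉ I ∧ ∀ B, B ∉ J → ∃ C ⊆ B, C ∉ J ∧ A ∩ f ⁻¹' C ∈ I := by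
  unfold BWle at h
  push Not at h
  obtain ⟨A, hA, hB⟩ := h f
  refine ⟨A, hA, fun B hBJ => ?_⟩
  by_cases hc : B ∩ f '' A ∈ J
  · refine ⟨B \ f '' A, diff_subset, ?_, ?_⟩
    · intro hd
      apply hBJ
      rw [← Set.inter_union_diff B (f '' A)]
      exact hJ.union_mem hc hd
    · refine hI.mem_of_subset ?_ (hI.finite_mem Set.finite_empty)
      rintro n ⟨hn, hn2⟩
      exact hn2.2 ⟨n, hn, rfl⟩
  · obtain ⟨C, hC1, hC2⟩ := hB _ inter_subset_right hc
    refine ⟨C ∩ (B ∩ f '' A), fun n hn => hn.2.1, hC1, ?_⟩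
    refine hI.mem_of_subset ?_ (not_not.1 fun hh => hh hC2)
    exact fun n hn => ⟨hn.1, hn.2.1⟩

theorem aux_fusion (J : Set (Set ℕ)) (hJ : IsIdeal J) (hJP : IsPPlus J)
    (I : Set (Set ℕ)) (hI : IsIdeal I) (f : ℕ → ℕ → ℕ) (A : ℕ → Set ℕ)
    (hd : ∀ k, ∀ B, B ∉ J → ∃ C ⊆ B, C ∉ J ∧ A k ∩ f k ⁻¹' C ∈ I)
    (B : Set ℕ) (hB : B ∉ J) :
    ∃ C ⊆ B, C ∉ J ∧ ∀ k, (∀ m, f k ⁻¹' {m} ∈ I) → A k ∩ f k ⁻¹' C ∈ I := by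
  choose g hg1 hg2 hg3 using hd
  let D : ℕ → {B : Set ℕ // B ∉ J} := fun n =>
    Nat.rec ⟨B, hB⟩ (fun k E => ⟨g k E.1 E.2, hg2 k E.1 E.2⟩) n
  obtain ⟨P, hP, hPD⟩ := hJP (fun n => (D n).1) (fun n => hg1 n _ (D n).2) (fun n => (D n).2)
  refine ⟨P ∩ B, inter_subset_right, ?_, ?_⟩
  · intro hc
    apply hP
    rw [← Set.inter_union_diff P B]
    exact hJ.union_mem hc (hJ.finite_mem (hPD 0))
  · intro k hk
    have h1 : A k ∩ f k ⁻¹' (D (k + 1)).1 ∈ I := hg3 k (D k).1 (D k).2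
    have h2 := aux_finite_iUnion I hI (hPD (k + 1)).toFinset (fun m => f k ⁻¹' {m})
      (fun m _ => hk m)
    refine hI.mem_of_subset ?_ (hI.union_mem h1 h2)
    rintro n ⟨hn, hn2⟩
    by_cases hm : f k n ∈ (D (k + 1)).1
    · exact Or.inl ⟨hn, hm⟩
    · right
      refine Set.mem_iUnion₂.2 ⟨f k n, ?_, rfl⟩
      rw [Set.Finite.mem_toFinset]
      exact ⟨hn2.1, hm⟩

theorem aux_index (hCH : Cardinal.continuum.{0} = Cardinal.aleph 1) :
    ∃ (W : Type) (_ : LinearOrder W) (f : W → (ℕ → ℕ)) (b : W → Set ℕ),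
      (∀ w : W, (Set.Iio w).Countable) ∧ Function.Surjective f ∧
      ∀ B, ¬ {w | b w = B}.Countable := by
  let W := (Cardinal.aleph 1).ord.ToType
  have hW : Cardinal.mk W = Cardinal.continuum := by
    rw [hCH]; exact Cardinal.mk_ord_toType _
  have hf : Cardinal.mk W = Cardinal.mk (ℕ → ℕ) := by
    rw [hW]; simp
  have hb : Cardinal.mk W = Cardinal.mk (Set ℕ × W) := by
    rw [Cardinal.mk_prod, hW]; simp
  obtain ⟨ef⟩ := Cardinal.eq.1 hf
  obtain ⟨eb⟩ := Cardinal.eq.1 hb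
  refine ⟨W, inferInstance, ef, fun w => (eb w).1, ?_, ef.surjective, ?_⟩
  · intro w
    rw [← Cardinal.le_aleph0_iff_set_countable, ← Cardinal.lt_aleph_one_iff]
    exact Cardinal.mk_Iio_toType_ord_lt w
  · intro B hc
    have h1 : (Set.univ : Set W).Countable := by
      refine (hc.image fun w => (eb w).2).mono ?_
      intro w _
      exact ⟨eb.symm (B, w), by simp, by simp⟩
    rw [← Cardinal.le_aleph0_iff_set_countable, Cardinal.mk_univ, hW] at h1
    exact absurd Cardinal.aleph0_lt_continuum (not_lt.2 h1)

theorem stmt18 (hCH : Cardinal.continuum = Cardinal.aleph 1)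
    (J : Set (Set ℕ)) (hJ : IsIdeal J) (hJP : IsPPlus J)
    (hJnm : IsNowhereMaximal J)
    (I : Set (Set ℕ)) (hI : IsIdeal I) (hIbw : HasHBW I)
    (h : ¬ BWle J I) :
    ∃ (X : Type) (_ : TopologicalSpace X), T2Space X ∧ ¬ CompactSpace X ∧
      BWProp I X ∧ ¬ BWProp J X := by
  classical
  have hCH0 : Cardinal.continuum.{0} = Cardinal.aleph 1 := by
    apply Cardinal.lift_injective
    rw [Cardinal.lift_continuum, Cardinal.lift_aleph, Ordinal.lift_one]
    exact hCH
  obtain ⟨W, _, f, b, hlt, hf, hb⟩ := aux_index hCH0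
  choose A hA hAd using aux_density J hJ I hI h
  have hC : ∀ w : W, ∃ C : Set ℕ, (b w ∉ J → C ⊆ b w ∧ C ∉ J) ∧
      ∀ v ≤ w, (∀ m, f v ⁻¹' {m} ∈ I) → A (f v) ∩ f v ⁻¹' C ∈ I := by
    intro w
    by_cases hw : b w ∈ J
    · refine ⟨∅, fun h => absurd hw h, fun v _ _ => ?_⟩
      simpa using hI.finite_mem Set.finite_empty
    · have hcount : (Set.Iic w).Countable := by
        rw [← Set.Iio_insert]
        exact (hlt w).insert w
      obtain ⟨g, hg⟩ := hcount.exists_eq_range ⟨w, le_rfl⟩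
      obtain ⟨C, h1, h2, h3⟩ := aux_fusion J hJ hJP I hI (fun k => f (g k))
        (fun k => A (f (g k))) (fun k => hAd (f (g k))) (b w) hw
      refine ⟨C, fun _ => ⟨h1, h2⟩, fun v hv hm => ?_⟩
      have : v ∈ Set.range g := hg ▸ hv
      obtain ⟨k, rfl⟩ := this
      exact h3 k hm
  choose C hC1 hC2 using hC
  let pt : ℕ → (W ⊕ ℕ → Bool) := fun n =>
    Sum.elim (fun w => decide (n ∈ C w)) (fun m => decide (n = m))
  have hWunc : ¬ (Set.univ : Set W).Countable := fun hc => hb ∅ (hc.mono (subset_univ _))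
  refine ⟨auxSpace pt, inferInstance, inferInstance, ?_, ?_, ?_⟩
  · intro hcomp
    have hcl : IsClosed (auxSpace pt) := (isCompact_iff_compactSpace.2 hcomp).isClosed
    let q : W ⊕ ℕ → Bool := Sum.elim (fun _ => true) (fun _ => false)
    have hq : q ∉ auxSpace pt := by
      rintro (⟨n, hn⟩ | ⟨_, hn⟩)
      · have := congrFun hn (Sum.inr n)
        simp [q, pt] at this
      · exact hWunc (hn.mono fun w _ => rfl)
    obtain ⟨F, u, hu, hF⟩ := isOpen_pi_iff.1 hcl.isOpen_compl q hq
    let r : W ⊕ ℕ → Bool := fun i => if i ∈ F then q i else false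
    have hr : r ∈ auxSpace pt := by
      right
      refine ⟨fun m => by simp [r, q], ?_⟩
      have hfin : {w : W | (Sum.inl w : W ⊕ ℕ) ∈ F}.Finite :=
        F.finite_toSet.preimage Sum.inl_injective.injOn
      refine hfin.countable.mono ?_
      intro w hw
      by_contra hne
      have hne' : (Sum.inl w : W ⊕ ℕ) ∉ F := hne
      simp [r, hne'] at hw
    refine hF ?_ hr
    intro i hi
    have hi' : i ∈ F := hi
    have : r i = q i := by simp [r, hi']
    rw [this]
    exact (hu i hi).2
  · intro x
    let S : Set ℕ := {n | ∃ k, (x n).1 = pt k}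
    by_cases hS : Sᶜ ∈ I
    · let g : ℕ → ℕ := fun n => if h : ∃ k, (x n).1 = pt k then h.choose else 0
      have hg : ∀ n ∈ S, (x n).1 = pt (g n) := by
        intro n hn
        have hn' : ∃ k, (x n).1 = pt k := hn
        simp only [g, hn', dif_pos]
        exact hn'.choose_spec
      have hSpos : ∀ B, B ∉ I → B ∩ S ∉ I := by
        intro B hB hBS
        apply hB
        refine hI.mem_of_subset ?_ (hI.union_mem hBS hS)
        intro n hn
        by_cases hnS : n ∈ S
        · exact Or.inl ⟨hn, hnS⟩
        · exact Or.inr hnS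
      by_cases hm : ∀ m, g ⁻¹' {m} ∈ I
      · obtain ⟨v, hv⟩ := hf g
        refine aux_limit I hI hIbw pt x (A g ∩ S) (hSpos _ (hA g)) (Set.Iio v) (hlt v) ?_ ?_
        · intro w hw
          have hvw : v ≤ w := not_lt.1 hw
          have := hC2 w v hvw (by rw [hv]; exact hm)
          rw [hv] at this
          refine hI.mem_of_subset ?_ this
          rintro n ⟨hn, hn2⟩
          refine ⟨hn.1, ?_⟩
          rw [hg n hn.2] at hn2
          exact of_decide_eq_true hn2
        · intro m
          refine hI.mem_of_subset ?_ (hm m)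
          rintro n ⟨hn, hn2⟩
          rw [hg n hn.2] at hn2
          simpa [pt] using hn2
      · push Not at hm
        obtain ⟨m, hm⟩ := hm
        refine ⟨g ⁻¹' {m} ∩ S, hSpos _ hm, ⟨pt m, Or.inl ⟨m, rfl⟩⟩, fun U _ hp => ?_⟩
        refine hI.mem_of_subset ?_ (hI.finite_mem Set.finite_empty)
        rintro n ⟨⟨hn, hnS⟩, hn2⟩
        apply hn2
        have : x n = ⟨pt m, Or.inl ⟨m, rfl⟩⟩ := by
          apply Subtype.ext
          have hn' : g n = m := hn
          rw [hg n hnS, hn']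
        rw [this]
        exact hp
    · have hx : ∀ n ∈ Sᶜ, (∀ m, (x n).1 (Sum.inr m) = false) ∧
          {w | (x n).1 (Sum.inl w) = true}.Countable := by
        intro n hn
        exact (x n).2.resolve_left hn
      refine aux_limit I hI hIbw pt x Sᶜ hS
        (⋃ n ∈ Sᶜ, {w | (x n).1 (Sum.inl w) = true}) ?_ ?_ ?_
      · exact (Set.to_countable _).biUnion fun n hn => (hx n hn).2
      · intro w hw
        refine hI.mem_of_subset ?_ (hI.finite_mem Set.finite_empty)
        rintro n ⟨hn, hn2⟩
        exact hw (Set.mem_iUnion₂.2 ⟨n, hn, hn2⟩)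
      · intro m
        refine hI.mem_of_subset ?_ (hI.finite_mem Set.finite_empty)
        rintro n ⟨hn, hn2⟩
        rw [(hx n hn).1 m] at hn2
        exact absurd hn2 (by simp)
  · intro hBW
    obtain ⟨B, hB, p, hp⟩ := hBW fun n => ⟨pt n, Or.inl ⟨n, rfl⟩⟩
    have hco : ∀ i, {n ∈ B | pt n i ≠ p.1 i} ∈ J := by
      intro i
      have ho : IsOpen {z : auxSpace pt | z.1 i = p.1 i} := by
        have h1 : Continuous fun z : auxSpace pt => z.1 i :=
          (continuous_apply i).comp continuous_subtype_val
        exact (isOpen_discrete {p.1 i}).preimage h1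
      exact hp _ ho rfl
    rcases p.2 with ⟨m, hm⟩ | ⟨_, hct⟩
    · apply hB
      refine hJ.mem_of_subset ?_ (hJ.union_mem (hco (Sum.inr m)) (hJ.finite_mem (finite_singleton m)))
      intro n hn
      by_cases hnm : n = m
      · exact Or.inr hnm
      · left
        refine ⟨hn, ?_⟩
        rw [hm]
        simp [pt, hnm]
    · have : ∃ w, b w = B ∧ p.1 (Sum.inl w) ≠ true := by
        by_contra hcon
        push Not at hcon
        exact hb B (hct.mono fun w hw => hcon w hw)
      obtain ⟨w, hw, hpw⟩ := this
      obtain ⟨hs, hpos⟩ := hC1 w (by rw [hw]; exact hB)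
      apply hpos
      refine hJ.mem_of_subset ?_ (hco (Sum.inl w))
      intro n hn
      refine ⟨hw ▸ hs hn, ?_⟩
      intro he
      apply hpw
      rw [← he]
      simpa [pt] using hn
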